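/- arXiv:1905.08121 — 3 statements merged into one kernel-verified Lean document; each statement's English description precedes it below -/
import Mathlib

section
/- Let n ≥ 1, 1 < p < ∞, 0 < q < p−1, 0 < α < n/p, and r > n(p−1)/(n−αp). Then there exist constants 0 < c ≤ C, depending only on α, p, q, r, n (not on σ or P), such that for every locally finite nonnegative Borel measure σ on ℝⁿ and every half-open dyadic cube P, c·∫_{P} sup_{R ∈ 𝒬 : x ∈ R, R ⊆ P} ( κ(R)^{q(p−1)/(p−1−q)} / |R|^{1−αp/n} )^{r/(p−1)} dx ≤ ∫_{P} ( K^{d,P}_{α,p,q}σ(x) )^{r} dx ≤ C·∫_{P} sup_{R ∈ 𝒬 : x ∈ R, R ⊆ P} ( κ(R)^{q(p−1)/(p−1−q)} / |R|^{1−αp/n} )^{r/(p−1)} dx. -/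
open MeasureTheory Metric Set
open scoped ENNReal NNReal

/-- The Wolff potential `W_{α,p}ν(x) = ∫₀^∞ (ν(B(x,ρ))/ρ^{n−αp})^{1/(p−1)} dρ/ρ`. -/
noncomputable def wolffPot (n : ℕ) (α p : ℝ)
    (ν : Measure (EuclideanSpace ℝ (Fin n))) (x : EuclideanSpace ℝ (Fin n)) : ℝ≥0∞ :=
  ∫⁻ ρ in Set.Ioi (0 : ℝ),
    (ν (Metric.ball x ρ) / ENNReal.ofReal (ρ ^ ((n : ℝ) - α * p))) ^ (1 / (p - 1)) /
      ENNReal.ofReal ρ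

/-- The least constant `κ(E)` such that
`(∫_E (W_{α,p}ν)^q dσ)^{1/q} ≤ κ · ν(ℝⁿ)^{1/(p−1)}` for all finite measures `ν`. -/
noncomputable def embC (n : ℕ) (α p q : ℝ) (σ : Measure (EuclideanSpace ℝ (Fin n)))
    (E : Set (EuclideanSpace ℝ (Fin n))) : ℝ≥0∞ :=
  sInf {κ : ℝ≥0∞ | ∀ ν : Measure (EuclideanSpace ℝ (Fin n)), IsFiniteMeasure ν →
    (∫⁻ y in E, wolffPot n α p ν y ^ q ∂σ) ^ (1 / q) ≤ κ * (ν Set.univ) ^ (1 / (p - 1))}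

/-- The intrinsic potential of Wolff type
`K_{α,p,q}σ(x) = ∫₀^∞ (κ(B(x,ρ))^{q(p−1)/(p−1−q)}/ρ^{n−αp})^{1/(p−1)} dρ/ρ`. -/
noncomputable def intK (n : ℕ) (α p q : ℝ) (σ : Measure (EuclideanSpace ℝ (Fin n)))
    (x : EuclideanSpace ℝ (Fin n)) : ℝ≥0∞ :=
  ∫⁻ ρ in Set.Ioi (0 : ℝ),
    (embC n α p q σ (Metric.ball x ρ) ^ (q * (p - 1) / (p - 1 - q)) /
      ENNReal.ofReal (ρ ^ ((n : ℝ) - α * p))) ^ (1 / (p - 1)) / ENNReal.ofReal ρ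

/-- The half-open dyadic cube `2^{−k}(m + [0,1)ⁿ)`. -/
def dyadicCube (n : ℕ) (k : ℤ) (m : Fin n → ℤ) : Set (EuclideanSpace ℝ (Fin n)) :=
  {x | ∀ i : Fin n, (m i : ℝ) * (2 : ℝ) ^ (-k) ≤ x i ∧ x i < ((m i : ℝ) + 1) * (2 : ℝ) ^ (-k)}

/-- The localized dyadic intrinsic potential
`K^{d,P}_{α,p,q}σ(x) = Σ_{Q ∈ 𝒬, Q ⊆ P} (κ(Q)^{q(p−1)/(p−1−q)}/|Q|^{1−αp/n})^{1/(p−1)} χ_Q(x)`,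
where `P = dyadicCube n k₀ m₀`. -/
noncomputable def intKdLoc (n : ℕ) (α p q : ℝ) (σ : Measure (EuclideanSpace ℝ (Fin n)))
    (k₀ : ℤ) (m₀ : Fin n → ℤ) (x : EuclideanSpace ℝ (Fin n)) : ℝ≥0∞ :=
  ∑' km : ℤ × (Fin n → ℤ),
    Set.indicator {km' : ℤ × (Fin n → ℤ) |
        dyadicCube n km'.1 km'.2 ⊆ dyadicCube n k₀ m₀}
      (fun km' => Set.indicator (dyadicCube n km'.1 km'.2)
        (fun _ => (embC n α p q σ (dyadicCube n km'.1 km'.2) ^ (q * (p - 1) / (p - 1 - q)) /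
          volume (dyadicCube n km'.1 km'.2) ^ (1 - α * p / (n : ℝ))) ^ (1 / (p - 1))) x) km

/-- The tangent-line bound for the convex function `t ↦ t ^ ρ`. -/
lemma ENNReal.add_rpow_le_rpow_add_mul {ρ : ℝ} (hρ : 1 < ρ) (b f : ℝ≥0∞) :
    (b + f) ^ ρ ≤ b ^ ρ + ENNReal.ofReal ρ * (f * (b + f) ^ (ρ - 1)) := by
  have h0 : ENNReal.ofReal ρ ≠ 0 := by simp; linarith
  rcases eq_or_ne b ∞ with rfl | hb
  · simp [ENNReal.top_rpow_of_pos (show 0 < ρ by linarith)]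
  rcases eq_or_ne f ∞ with rfl | hf
  · simp [ENNReal.top_rpow_of_pos (show 0 < ρ - 1 by linarith), ENNReal.mul_top, h0]
  lift b to ℝ≥0 using hb
  lift f to ℝ≥0 using hf
  rcases eq_or_ne (b + f) 0 with hy | hy
  · have : (b : ℝ≥0∞) + f = 0 := by exact_mod_cast hy
    rw [this, ENNReal.zero_rpow_of_pos (by linarith)]
    exact zero_le
  have hy' : (0 : ℝ) < b + f := by exact_mod_cast pos_iff_ne_zero.2 hy
  have key : ((b : ℝ) + f) ^ ρ ≤ (b : ℝ) ^ ρ + ρ * (f * ((b : ℝ) + f) ^ (ρ - 1)) := by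
    have h1 := one_add_mul_self_le_rpow_one_add (s := -(f / (b + f) : ℝ))
      (by rw [neg_le_neg_iff, div_le_one hy']; linarith [b.coe_nonneg]) hρ.le
    have h2 : 1 + -(f / (b + f) : ℝ) = b / (b + f) := by field_simp; ring
    rw [h2, Real.div_rpow b.coe_nonneg hy'.le, le_div_iff₀ (by positivity)] at h1
    have h3 : ((b : ℝ) + f) ^ ρ = ((b : ℝ) + f) ^ (ρ - 1) * (b + f) := by
      rw [← Real.rpow_add_one hy'.ne']; simp
    have h4 : (1 + ρ * -(f / (b + f) : ℝ)) * ((b : ℝ) + f) ^ ρ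
        = ((b : ℝ) + f) ^ ρ - ρ * (f * ((b : ℝ) + f) ^ (ρ - 1)) := by
      rw [h3]; field_simp; ring
    linarith
  have e1 : ((b : ℝ≥0∞) + f) = ((b + f : ℝ≥0) : ℝ≥0∞) := by push_cast; rfl
  rw [e1, ENNReal.ofReal, ← ENNReal.coe_rpow_of_nonneg _ (by linarith),
    ← ENNReal.coe_rpow_of_nonneg _ (by linarith), ← ENNReal.coe_rpow_of_nonneg _ (by linarith)]
  norm_cast
  rw [← NNReal.coe_le_coe]
  push_cast
  rw [Real.coe_toNNReal _ (by linarith)]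
  exact key

/-- Summation by parts for `ρ`-th powers of partial sums. -/
lemma ENNReal.sum_rpow_le_mul_sum {ρ : ℝ} (hρ : 1 < ρ) (f : ℕ → ℝ≥0∞) (N : ℕ) :
    (∑ j ∈ Finset.range N, f j) ^ ρ ≤ ENNReal.ofReal ρ *
      ∑ j ∈ Finset.range N, f j * (∑ i ∈ Finset.range (j + 1), f i) ^ (ρ - 1) := by
  induction N with
  | zero => simp [ENNReal.zero_rpow_of_pos (show 0 < ρ by linarith)]
  | succ N ih =>
    rw [Finset.sum_range_succ (fun j => f j * _), mul_add]
    have := ENNReal.add_rpow_le_rpow_add_mul hρ (∑ j ∈ Finset.range N, f j) (f N)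
    rw [← Finset.sum_range_succ] at this
    exact this.trans (by gcongr)

lemma ENNReal.sum_mul_le_sum_succ_mul_add (f S : ℕ → ℝ≥0∞) (hS : Monotone S) (M : ℝ≥0∞)
    (hf : ∀ j, f j ≤ M) (N : ℕ) :
    ∑ j ∈ Finset.range (N + 1), f j * S j ≤
      ∑ j ∈ Finset.range N, f (j + 1) * S j + M * S N := by
  induction N with
  | zero => simpa using mul_le_mul_left (hf 0) (S 0)
  | succ N ih =>
    rw [Finset.sum_range_succ, Finset.sum_range_succ (fun j => f (j + 1) * S j)]
    obtain ⟨d, hd⟩ := exists_add_of_le (hf (N + 1))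
    obtain ⟨e, he⟩ := exists_add_of_le (hS (Nat.le_succ N))
    have : M * S N + f (N + 1) * S (N + 1) ≤ f (N + 1) * S N + M * S (N + 1) := by
      simp only [Nat.succ_eq_add_one] at he
      rw [he, hd]
      calc _ = f (N + 1) * S N + (f (N + 1) + d) * S N + f (N + 1) * e := by ring
        _ ≤ f (N + 1) * S N + (f (N + 1) + d) * S N + f (N + 1) * e + d * e := le_self_add
        _ = _ := by ring
    calc _ ≤ ∑ j ∈ Finset.range N, f (j + 1) * S j + M * S N + f (N + 1) * S (N + 1) := by gcongr
      _ = ∑ j ∈ Finset.range N, f (j + 1) * S j + (M * S N + f (N + 1) * S (N + 1)) := by ring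
      _ ≤ ∑ j ∈ Finset.range N, f (j + 1) * S j + (f (N + 1) * S N + M * S (N + 1)) := by gcongr
      _ = _ := by ring

lemma ENNReal.mul_rpow_sub_one_le {ρ : ℝ} (hρ : 1 < ρ) {η : ℝ≥0∞} (hη0 : η ≠ 0) (hη : η ≠ ∞)
    (M B : ℝ≥0∞) : M * B ^ (ρ - 1) ≤ η * B ^ ρ + η⁻¹ ^ (ρ - 1) * M ^ ρ := by
  have key : ∀ x : ℝ≥0∞, x ^ ρ = x * x ^ (ρ - 1) := fun x => by
    conv_rhs => enter [1]; rw [← ENNReal.rpow_one x]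
    rw [← ENNReal.rpow_add_of_nonneg _ _ zero_le_one (by linarith)]
    congr 1; ring
  rcases le_total M (η * B) with h | h
  · refine le_trans ?_ le_self_add
    rw [key B, ← mul_assoc]
    gcongr
  · refine le_trans ?_ le_add_self
    have : B ≤ η⁻¹ * M := by
      rw [mul_comm, ← div_eq_mul_inv, ENNReal.le_div_iff_mul_le (Or.inl hη0) (Or.inl hη), mul_comm]
      exact h
    calc M * B ^ (ρ - 1) ≤ M * (η⁻¹ * M) ^ (ρ - 1) := by gcongr
      _ = _ := by rw [ENNReal.mul_rpow_of_nonneg _ _ (by linarith), key M]; ring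

lemma ENNReal.sum_rpow_le_rpow_sum {ι : Type*} (s : Finset ι) (f : ι → ℝ≥0∞) {θ : ℝ}
    (h0 : 0 < θ) (h1 : θ ≤ 1) : (∑ i ∈ s, f i) ^ θ ≤ ∑ i ∈ s, f i ^ θ := by
  classical
  induction s using Finset.induction_on with
  | empty => simp [h0]
  | insert a s ha ih =>
    rw [Finset.sum_insert ha, Finset.sum_insert ha]
    exact (ENNReal.rpow_add_le_add_rpow _ _ h0.le h1).trans (by gcongr)

/-- The index of the dyadic cube of side length `2 ^ (-k)` containing `x`. -/
noncomputable def dyadicIndex (n : ℕ) (k : ℤ) (x : EuclideanSpace ℝ (Fin n)) : Fin n → ℤ :=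
  fun i => ⌊x i * (2 : ℝ) ^ k⌋

/-- The indices of the `2 ^ n` dyadic children of a cube with index `m`. -/
def dyadicChildren (n : ℕ) (m : Fin n → ℤ) : Finset (Fin n → ℤ) :=
  Fintype.piFinset fun i => {2 * m i, 2 * m i + 1}

lemma mem_dyadicCube_iff {n : ℕ} {k : ℤ} {m : Fin n → ℤ} {x : EuclideanSpace ℝ (Fin n)} :
    x ∈ dyadicCube n k m ↔ dyadicIndex n k x = m := by
  have h2 : (0 : ℝ) < 2 ^ k := by positivity
  simp only [dyadicCube, mem_ofPred_eq, dyadicIndex, funext_iff, Int.floor_eq_iff, zpow_neg,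
    ← div_eq_mul_inv]
  simp only [div_le_iff₀ h2, lt_div_iff₀ h2]

lemma mem_dyadicCube_dyadicIndex {n : ℕ} (k : ℤ) (x : EuclideanSpace ℝ (Fin n)) :
    x ∈ dyadicCube n k (dyadicIndex n k x) :=
  mem_dyadicCube_iff.2 rfl

lemma dyadicIndex_eq_div_two {n : ℕ} (k : ℤ) (x : EuclideanSpace ℝ (Fin n)) (i : Fin n) :
    dyadicIndex n k x i = dyadicIndex n (k + 1) x i / 2 := by
  have := Int.floor_div_natCast (x i * (2 : ℝ) ^ (k + 1)) 2
  simp only [dyadicIndex]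
  push_cast at this
  rw [← this]
  congr 1
  rw [zpow_add_one₀ two_ne_zero]
  ring

lemma dyadicIndex_eq_of_le {n : ℕ} {k l : ℤ} (hkl : k ≤ l) {x y : EuclideanSpace ℝ (Fin n)}
    (h : dyadicIndex n l x = dyadicIndex n l y) : dyadicIndex n k x = dyadicIndex n k y := by
  induction k, hkl using Int.leInductionDown with
  | base => exact h
  | pred k _ ih =>
    funext i
    rw [dyadicIndex_eq_div_two, dyadicIndex_eq_div_two (k - 1) y, sub_add_cancel, ih]

lemma dyadicCube_subset_of_mem {n : ℕ} {k l : ℤ} (hkl : k ≤ l) {m m' : Fin n → ℤ}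
    {x : EuclideanSpace ℝ (Fin n)} (hx : x ∈ dyadicCube n k m) (hx' : x ∈ dyadicCube n l m') :
    dyadicCube n l m' ⊆ dyadicCube n k m := by
  intro y hy
  rw [mem_dyadicCube_iff] at *
  rw [← hx]
  exact dyadicIndex_eq_of_le hkl (hy.trans hx'.symm)

lemma dyadicIndex_mem_dyadicChildren_iff {n : ℕ} {k : ℤ} {m : Fin n → ℤ}
    {x : EuclideanSpace ℝ (Fin n)} :
    dyadicIndex n (k + 1) x ∈ dyadicChildren n m ↔ dyadicIndex n k x = m := by
  simp only [dyadicChildren, Fintype.mem_piFinset, Finset.mem_insert, Finset.mem_singleton,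
    funext_iff]
  refine forall_congr' fun i => ?_
  rw [dyadicIndex_eq_div_two k]
  omega

lemma dyadicCube_eq_biUnion_children {n : ℕ} (k : ℤ) (m : Fin n → ℤ) :
    dyadicCube n k m = ⋃ m' ∈ dyadicChildren n m, dyadicCube n (k + 1) m' := by
  ext x
  simp only [mem_iUnion, mem_dyadicCube_iff, exists_prop, exists_eq_right',
    dyadicIndex_mem_dyadicChildren_iff]

lemma disjoint_dyadicCube {n : ℕ} (k : ℤ) {m m' : Fin n → ℤ} (h : m ≠ m') :
    Disjoint (dyadicCube n k m) (dyadicCube n k m') :=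
  Set.disjoint_left.2 fun _ hx hx' =>
    h ((mem_dyadicCube_iff.1 hx).symm.trans (mem_dyadicCube_iff.1 hx'))

lemma card_dyadicChildren {n : ℕ} (m : Fin n → ℤ) : (dyadicChildren n m).card = 2 ^ n := by
  simp [dyadicChildren, Fintype.card_piFinset]

lemma measurable_dyadicIndex {n : ℕ} (k : ℤ) : Measurable (dyadicIndex n k) := by
  refine measurable_pi_lambda _ fun i => Int.measurable_floor.comp ?_
  fun_prop

lemma measurableSet_dyadicCube {n : ℕ} (k : ℤ) (m : Fin n → ℤ) :
    MeasurableSet (dyadicCube n k m) := by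
  have : dyadicCube n k m = dyadicIndex n k ⁻¹' {m} := by ext; simp [mem_dyadicCube_iff]
  rw [this]
  exact measurable_dyadicIndex k (measurableSet_singleton m)

lemma volume_dyadicCube {n : ℕ} (k : ℤ) (m : Fin n → ℤ) :
    volume (dyadicCube n k m) = (ENNReal.ofReal ((2 : ℝ) ^ (-k))) ^ n := by
  have : dyadicCube n k m = (WithLp.ofLp : EuclideanSpace ℝ (Fin n) → (Fin n → ℝ)) ⁻¹'
      (Set.pi univ fun i => Ico ((m i : ℝ) * (2 : ℝ) ^ (-k)) (((m i : ℝ) + 1) * (2 : ℝ) ^ (-k))) := by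
    ext; simp [dyadicCube]
  rw [this, (PiLp.volume_preserving_ofLp (Fin n)).measure_preimage
    (MeasurableSet.univ_pi fun i => measurableSet_Ico).nullMeasurableSet, Real.volume_pi_Ico]
  simp [add_mul]

lemma volume_dyadicCube_ne_zero {n : ℕ} (k : ℤ) (m : Fin n → ℤ) :
    volume (dyadicCube n k m) ≠ 0 := by
  rw [volume_dyadicCube]
  exact pow_ne_zero _ (ENNReal.ofReal_pos.2 (by positivity)).ne'

lemma volume_dyadicCube_ne_top {n : ℕ} (k : ℤ) (m : Fin n → ℤ) :
    volume (dyadicCube n k m) ≠ ∞ := by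
  rw [volume_dyadicCube]
  exact ENNReal.pow_ne_top ENNReal.ofReal_ne_top

lemma volume_dyadicCube_succ {n : ℕ} (k : ℤ) (m m' : Fin n → ℤ) :
    volume (dyadicCube n (k + 1) m') = 2⁻¹ ^ n * volume (dyadicCube n k m) := by
  rw [volume_dyadicCube, volume_dyadicCube, ← mul_pow]
  congr 1
  rw [neg_add, zpow_add₀ two_ne_zero, ENNReal.ofReal_mul (by positivity), mul_comm]
  congr 1
  rw [zpow_neg_one, ENNReal.ofReal_inv_of_pos two_pos]
  simp

lemma le_of_dyadicCube_subset {n : ℕ} (hn : 1 ≤ n) {k l : ℤ} {m m' : Fin n → ℤ}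
    (h : dyadicCube n l m' ⊆ dyadicCube n k m) : k ≤ l := by
  have h1 := measure_mono (μ := volume) h
  rw [volume_dyadicCube, volume_dyadicCube, ENNReal.pow_le_pow_left_iff (by omega),
    ENNReal.ofReal_le_ofReal_iff (by positivity), zpow_le_zpow_iff_right₀ one_lt_two] at h1
  omega

/-- An integral over a dyadic cube is the sum of the integrals over its children. -/
lemma lintegral_dyadicCube_eq_sum_children {n : ℕ} (k : ℤ) (m : Fin n → ℤ)
    (F : EuclideanSpace ℝ (Fin n) → ℝ≥0∞) :
    ∫⁻ x in dyadicCube n k m, F x =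
      ∑ m' ∈ dyadicChildren n m, ∫⁻ x in dyadicCube n (k + 1) m', F x := by
  rw [dyadicCube_eq_biUnion_children, lintegral_biUnion_finset
    (fun a _ b _ hab => disjoint_dyadicCube _ hab) (fun _ _ => measurableSet_dyadicCube _ _)]

/-- Contraction of consecutive generations, tested against a weight that is constant on the
cubes of the coarser generation. -/
lemma lintegral_succ_mul_le {n : ℕ} {δ : ℝ≥0∞} (lam : ℤ → (Fin n → ℤ) → ℝ≥0∞)
    (hlam : ∀ k m, ∑ m' ∈ dyadicChildren n m, lam (k + 1) m' * volume (dyadicCube n (k + 1) m') ≤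
      δ * (lam k m * volume (dyadicCube n k m)))
    (l : ℤ) (G : EuclideanSpace ℝ (Fin n) → ℝ≥0∞)
    (hG : ∀ x y, dyadicIndex n l x = dyadicIndex n l y → G x = G y) (j : ℕ) (m : Fin n → ℤ) :
    ∫⁻ x in dyadicCube n (l - j) m, lam (l + 1) (dyadicIndex n (l + 1) x) * G x ≤
      δ * ∫⁻ x in dyadicCube n (l - j) m, lam l (dyadicIndex n l x) * G x := by
  induction j generalizing m with
  | zero =>
    simp only [Nat.cast_zero, sub_zero]
    rcases (dyadicCube n l m).eq_empty_or_nonempty with h | ⟨z, hz⟩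
    · simp [h]
    have hz' := mem_dyadicCube_iff.1 hz
    have hGz : ∀ x ∈ dyadicCube n l m, G x = G z := fun x hx =>
      hG x z ((mem_dyadicCube_iff.1 hx).trans hz'.symm)
    have e1 : ∫⁻ x in dyadicCube n l m, lam l (dyadicIndex n l x) * G x =
        lam l m * G z * volume (dyadicCube n l m) := by
      rw [← setLIntegral_const]
      refine setLIntegral_congr_fun (measurableSet_dyadicCube _ _) fun x hx => ?_
      simp only [hGz x hx, mem_dyadicCube_iff.1 hx]
    have e2 : ∫⁻ x in dyadicCube n l m, lam (l + 1) (dyadicIndex n (l + 1) x) * G x =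
        ∑ m' ∈ dyadicChildren n m, lam (l + 1) m' * G z * volume (dyadicCube n (l + 1) m') := by
      rw [lintegral_dyadicCube_eq_sum_children]
      refine Finset.sum_congr rfl fun m' hm' => ?_
      rw [← setLIntegral_const]
      refine setLIntegral_congr_fun (measurableSet_dyadicCube _ _) fun x hx => ?_
      have hx' : x ∈ dyadicCube n l m := by
        rw [dyadicCube_eq_biUnion_children]
        exact mem_biUnion hm' hx
      simp only [hGz x hx', mem_dyadicCube_iff.1 hx]
    rw [e1, e2]
    calc _ = (∑ m' ∈ dyadicChildren n m,
          lam (l + 1) m' * volume (dyadicCube n (l + 1) m')) * G z := by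
          rw [Finset.sum_mul]; exact Finset.sum_congr rfl fun _ _ => by ring
      _ ≤ δ * (lam l m * volume (dyadicCube n l m)) * G z := by gcongr; exact hlam l m
      _ = _ := by ring
  | succ j ih =>
    rw [lintegral_dyadicCube_eq_sum_children, lintegral_dyadicCube_eq_sum_children (F := fun x =>
      lam l (dyadicIndex n l x) * G x), Finset.mul_sum]
    have : l - ((j + 1 : ℕ) : ℤ) + 1 = l - j := by push_cast; ring
    rw [this]
    exact Finset.sum_le_sum fun m' _ => ih m'

/-- If the generations of `lam` contract in mean, then the partial sums of `lam` along the cubes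
containing a point are controlled in `L^ρ` by any majorant of the single terms. -/
lemma exists_lintegral_sum_rpow_le (n : ℕ) {ρ : ℝ} (hρ : 1 < ρ) {δ : ℝ} (hδ0 : 0 ≤ δ)
    (hδ1 : δ < 1) : ∃ C : ℝ≥0∞, C ≠ ∞ ∧ ∀ lam : ℤ → (Fin n → ℤ) → ℝ≥0∞,
      (∀ k m, ∑ m' ∈ dyadicChildren n m, lam (k + 1) m' * volume (dyadicCube n (k + 1) m') ≤
        ENNReal.ofReal δ * (lam k m * volume (dyadicCube n k m))) →
      ∀ (k₀ : ℤ) (m₀ : Fin n → ℤ) (M : EuclideanSpace ℝ (Fin n) → ℝ≥0∞),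
        (∀ x ∈ dyadicCube n k₀ m₀, ∀ j : ℕ, lam (k₀ + j) (dyadicIndex n (k₀ + j) x) ≤ M x) →
        ∀ N : ℕ, ∫⁻ x in dyadicCube n k₀ m₀,
          (∑ j ∈ Finset.range N, lam (k₀ + j) (dyadicIndex n (k₀ + j) x)) ^ ρ ≤
            C * ∫⁻ x in dyadicCube n k₀ m₀, M x ^ ρ := by
  have hρ0 : 0 < ρ := by linarith
  set η : ℝ≥0∞ := ENNReal.ofReal ((1 - δ) / (2 * ρ)) with hη
  have hη0 : η ≠ 0 := by
    rw [hη]; exact (ENNReal.ofReal_pos.2 (div_pos (by linarith) (by linarith))).ne'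
  have hηt : η ≠ ∞ := ENNReal.ofReal_ne_top
  set K : ℝ≥0∞ := η⁻¹ ^ (ρ - 1) with hK
  have hKt : K ≠ ∞ := ENNReal.rpow_ne_top_of_nonneg (by linarith) (ENNReal.inv_ne_top.2 hη0)
  set τ : ℝ≥0∞ := ENNReal.ofReal ((1 - δ) / 2) with hτ
  have hτ0 : τ ≠ 0 := by rw [hτ]; exact (ENNReal.ofReal_pos.2 (by linarith)).ne'
  have hτt : τ ≠ ∞ := ENNReal.ofReal_ne_top
  refine ⟨ENNReal.ofReal ρ * (τ⁻¹ * K), ENNReal.mul_ne_top ENNReal.ofReal_ne_top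
    (ENNReal.mul_ne_top (ENNReal.inv_ne_top.2 hτ0) hKt), ?_⟩
  intro lam hlam k₀ m₀ M hM N
  set P := dyadicCube n k₀ m₀ with hP
  set X := ∫⁻ x in P, M x ^ ρ with hX
  rcases eq_or_ne X ∞ with hXt | hXt
  · rw [hXt, ENNReal.mul_top]
    · exact le_top
    · refine mul_ne_zero (ENNReal.ofReal_pos.2 hρ0).ne' (mul_ne_zero (ENNReal.inv_ne_zero.2 hτt) ?_)
      exact (ENNReal.rpow_pos (pos_iff_ne_zero.2 (ENNReal.inv_ne_zero.2 hηt))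
        (ENNReal.inv_ne_top.2 hη0)).ne'
  rcases N with _ | N
  · simp [ENNReal.zero_rpow_of_pos hρ0]
  set f : ℕ → EuclideanSpace ℝ (Fin n) → ℝ≥0∞ :=
    fun j x => lam (k₀ + j) (dyadicIndex n (k₀ + j) x) with hf
  have hfm : ∀ j, Measurable (f j) := fun j =>
    (Measurable.of_discrete (f := lam (k₀ + j))).comp (measurable_dyadicIndex _)
  set B : ℕ → EuclideanSpace ℝ (Fin n) → ℝ≥0∞ := fun j x => ∑ i ∈ Finset.range j, f i x with hB
  have hBm : ∀ j, Measurable (B j) := fun j => Finset.measurable_fun_sum _ fun i _ => hfm i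
  set S : ℕ → EuclideanSpace ℝ (Fin n) → ℝ≥0∞ := fun j x => B (j + 1) x ^ (ρ - 1) with hS
  have hSm : ∀ j, Measurable (S j) := fun j => (hBm _).pow_const _
  have hfS : ∀ i j, Measurable fun x => f i x * S j x := fun i j => (hfm i).mul (hSm j)
  have hSmono : ∀ x, Monotone fun j => S j x := fun x =>
    monotone_nat_of_le_succ fun j => by
      refine ENNReal.rpow_le_rpow ?_ (by linarith)
      exact Finset.sum_le_sum_of_subset (by simp)
  set I : ℝ≥0∞ := ∫⁻ x in P, ∑ j ∈ Finset.range (N + 1), f j x * S j x with hI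
  have hstep : ∀ j, ∫⁻ x in P, f (j + 1) x * S j x ≤
      ENNReal.ofReal δ * ∫⁻ x in P, f j x * S j x := by
    intro j
    have hconst : ∀ x y, dyadicIndex n (k₀ + j) x = dyadicIndex n (k₀ + j) y → S j x = S j y := by
      intro x y hxy
      have : B (j + 1) x = B (j + 1) y := by
        refine Finset.sum_congr rfl fun i hi => ?_
        have hij : i ≤ j := Nat.lt_succ_iff.1 (Finset.mem_range.1 hi)
        simp only [hf]
        rw [dyadicIndex_eq_of_le (by omega) hxy]
      simp only [hS, this]
    have := lintegral_succ_mul_le lam hlam (k₀ + j) (S j) hconst j m₀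
    rw [add_sub_cancel_right] at this
    simpa only [hf, Nat.cast_add, Nat.cast_one, add_assoc] using this
  have hBI : ∫⁻ x in P, B (N + 1) x ^ ρ ≤ ENNReal.ofReal ρ * I := by
    rw [hI, ← lintegral_const_mul' _ _ ENNReal.ofReal_ne_top]
    exact lintegral_mono fun x => ENNReal.sum_rpow_le_mul_sum hρ (fun j => f j x) (N + 1)
  have hfM : ∀ x ∈ P, ∀ j, f j x ≤ M x := hM
  have hI1 : I ≤ ENNReal.ofReal δ * I + (η * (ENNReal.ofReal ρ * I) + K * X) := by
    calc I ≤ ∫⁻ x in P, (∑ j ∈ Finset.range N, f (j + 1) x * S j x +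
          (η * B (N + 1) x ^ ρ + K * M x ^ ρ)) := by
          refine setLIntegral_mono' (measurableSet_dyadicCube _ _) fun x hx => ?_
          refine (ENNReal.sum_mul_le_sum_succ_mul_add (fun j => f j x) (fun j => S j x)
            (hSmono x) (M x) (hfM x hx) N).trans ?_
          gcongr
          exact ENNReal.mul_rpow_sub_one_le hρ hη0 hηt _ _
      _ = ∑ j ∈ Finset.range N, (∫⁻ x in P, f (j + 1) x * S j x) +
          (η * (∫⁻ x in P, B (N + 1) x ^ ρ) + K * X) := by
          rw [lintegral_add_left (Finset.measurable_fun_sum _ fun j _ => hfS (j + 1) j),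
            lintegral_finsetSum _ fun j _ => hfS (j + 1) j,
            lintegral_add_left (((hBm _).pow_const _).const_mul _),
            lintegral_const_mul' _ _ hηt, lintegral_const_mul' _ _ hKt]
      _ ≤ _ := by
          gcongr
          rw [hI, lintegral_finsetSum _ fun j _ => hfS j j, Finset.mul_sum]
          exact (Finset.sum_le_sum fun j _ => hstep j).trans
            (Finset.sum_le_sum_of_subset (by simp))
  have hIt : I ≠ ∞ := by
    have hBM : ∀ x ∈ P, ∀ j ≤ N + 1, B j x ≤ (N + 1 : ℕ) * M x := fun x hx j hj => by
      refine (Finset.sum_le_sum fun i _ => hfM x hx i).trans ?_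
      rw [Finset.sum_const, Finset.card_range, nsmul_eq_mul]
      gcongr
    have : I ≤ ∫⁻ x in P, ((N + 1 : ℕ) * ((N + 1 : ℕ) : ℝ≥0∞) ^ (ρ - 1)) * M x ^ ρ := by
      refine setLIntegral_mono' (measurableSet_dyadicCube _ _) fun x hx => ?_
      calc _ ≤ ∑ j ∈ Finset.range (N + 1), M x * ((N + 1 : ℕ) * M x) ^ (ρ - 1) := by
            refine Finset.sum_le_sum fun j hj => mul_le_mul' (hfM x hx j) ?_
            exact ENNReal.rpow_le_rpow (hBM x hx _ (by have := Finset.mem_range.1 hj; omega))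
              (by linarith)
        _ = _ := by
            rw [Finset.sum_const, Finset.card_range, nsmul_eq_mul,
              ENNReal.mul_rpow_of_nonneg _ _ (by linarith)]
            have : M x ^ ρ = M x * M x ^ (ρ - 1) := by
              conv_rhs => enter [1]; rw [← ENNReal.rpow_one (M x)]
              rw [← ENNReal.rpow_add_of_nonneg _ _ zero_le_one (by linarith)]
              congr 1; ring
            rw [this]; ring
    refine ne_top_of_le_ne_top ?_ this
    have hc : ((N + 1 : ℕ) * ((N + 1 : ℕ) : ℝ≥0∞) ^ (ρ - 1)) ≠ ∞ :=
      ENNReal.mul_ne_top (ENNReal.natCast_ne_top _)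
        (ENNReal.rpow_ne_top_of_nonneg (by linarith) (ENNReal.natCast_ne_top _))
    rw [lintegral_const_mul' _ _ hc]
    exact ENNReal.mul_ne_top hc hXt
  have hηρ : η * ENNReal.ofReal ρ = τ := by
    rw [hη, hτ, ← ENNReal.ofReal_mul (by apply div_nonneg <;> linarith)]
    congr 1
    field_simp
  have hsum : ENNReal.ofReal δ + τ + τ = 1 := by
    rw [hτ, ← ENNReal.ofReal_add hδ0 (by linarith),
      ← ENNReal.ofReal_add (by linarith) (by linarith)]
    ring_nf
    simp
  have hI2 : τ * I ≤ K * X := by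
    have e : (ENNReal.ofReal δ + τ) * I + τ * I ≤ (ENNReal.ofReal δ + τ) * I + K * X := by
      rw [← add_mul, hsum, one_mul]
      refine hI1.trans (le_of_eq ?_)
      rw [← hηρ]; ring
    exact (ENNReal.add_le_add_iff_left (ENNReal.mul_ne_top
      (ENNReal.add_ne_top.2 ⟨ENNReal.ofReal_ne_top, hτt⟩) hIt)).1 e
  calc ∫⁻ x in P, B (N + 1) x ^ ρ ≤ ENNReal.ofReal ρ * I := hBI
    _ ≤ ENNReal.ofReal ρ * (τ⁻¹ * K * X) := by
        gcongr
        rw [mul_assoc, mul_comm, ← div_eq_mul_inv, ENNReal.le_div_iff_mul_le (Or.inl hτ0)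
          (Or.inl hτt), mul_comm]
        exact hI2
    _ = _ := by ring

lemma wolffPot_mono {n : ℕ} {α p : ℝ} (hp : 1 < p) {ν ν' : Measure (EuclideanSpace ℝ (Fin n))}
    (h : ν ≤ ν') (x : EuclideanSpace ℝ (Fin n)) : wolffPot n α p ν x ≤ wolffPot n α p ν' x := by
  refine lintegral_mono fun ρ => ?_
  have : 0 ≤ 1 / (p - 1) := by apply div_nonneg <;> linarith
  gcongr

lemma wolffPot_smul {n : ℕ} {α p : ℝ} (hp : 1 < p) (ν : Measure (EuclideanSpace ℝ (Fin n)))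
    {c : ℝ≥0∞} (hc : c ≠ ∞) (x : EuclideanSpace ℝ (Fin n)) :
    wolffPot n α p (c • ν) x = c ^ (1 / (p - 1)) * wolffPot n α p ν x := by
  have : 0 ≤ 1 / (p - 1) := by apply div_nonneg <;> linarith
  rw [wolffPot, wolffPot, ← lintegral_const_mul' _ _ (ENNReal.rpow_ne_top_of_nonneg this hc)]
  refine lintegral_congr fun ρ => ?_
  rw [Measure.smul_apply, smul_eq_mul, mul_div_assoc, ENNReal.mul_rpow_of_nonneg _ _ this,
    mul_div_assoc]

lemma wolffPot_zero {n : ℕ} {α p : ℝ} (hp : 1 < p) (x : EuclideanSpace ℝ (Fin n)) :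
    wolffPot n α p 0 x = 0 := by
  have : 0 < 1 / (p - 1) := by apply div_pos <;> linarith
  have h := wolffPot_smul (α := α) hp (0 : Measure (EuclideanSpace ℝ (Fin n)))
    ENNReal.zero_ne_top x
  rwa [smul_zero, ENNReal.zero_rpow_of_pos this, zero_mul] at h

/-- Below the embedding constant, a nonzero finite measure violates the inequality. -/
lemma exists_lt_of_lt_embC {n : ℕ} {α p q : ℝ} (hp : 1 < p) (hq : 0 < q)
    {σ : Measure (EuclideanSpace ℝ (Fin n))} {E : Set (EuclideanSpace ℝ (Fin n))} {a : ℝ≥0∞}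
    (ha : a < embC n α p q σ E) : ∃ ν : Measure (EuclideanSpace ℝ (Fin n)), IsFiniteMeasure ν ∧
      ν univ ≠ 0 ∧ (a * ν univ ^ (1 / (p - 1))) ^ q ≤ ∫⁻ y in E, wolffPot n α p ν y ^ q ∂σ := by
  have h := notMem_of_lt_csInf' ha
  simp only [mem_ofPred_eq, not_forall, not_le] at h
  obtain ⟨ν, hν, h⟩ := h
  refine ⟨ν, hν, fun h0 => ?_, ?_⟩
  · rw [Measure.measure_univ_eq_zero] at h0
    simp [h0, wolffPot_zero hp, ENNReal.zero_rpow_of_pos hq, ENNReal.zero_rpow_of_pos (inv_pos.2 hq)] at h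
  · have := ENNReal.rpow_le_rpow h.le hq.le
    rwa [← ENNReal.rpow_mul, one_div_mul_cancel hq.ne', ENNReal.rpow_one] at this

/-- Superadditivity of `κ ^ (q (p - 1) / (p - 1 - q))`. -/
lemma sum_embC_rpow_le {n : ℕ} {α p q : ℝ} (hp : 1 < p) (hq : 0 < q) (hqp : q < p - 1)
    (σ : Measure (EuclideanSpace ℝ (Fin n))) {ι : Type*} (s : Finset ι)
    (E : ι → Set (EuclideanSpace ℝ (Fin n))) (hE : ∀ i ∈ s, MeasurableSet (E i))
    (hd : Set.PairwiseDisjoint (s : Set ι) E) :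
    ∑ i ∈ s, embC n α p q σ (E i) ^ (q * (p - 1) / (p - 1 - q)) ≤
      embC n α p q σ (⋃ i ∈ s, E i) ^ (q * (p - 1) / (p - 1 - q)) := by
  set t := q * (p - 1) / (p - 1 - q) with ht
  have hp1 : 0 < p - 1 := by linarith
  have hpq : 0 < p - 1 - q := by linarith
  have ht0 : 0 < t := by rw [ht]; positivity
  set u := 1 / (p - 1) with hu
  have hu0 : 0 < u := by rw [hu]; positivity
  have huq : 0 < 1 - u * q := by
    have : 1 - u * q = (p - 1 - q) / (p - 1) := by rw [hu]; field_simp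
    rw [this]; positivity
  have htu : t * (u * q) + q = t := by rw [ht, hu]; field_simp; ring
  have htu' : q * (1 / (1 - u * q)) = t := by
    have : 1 - u * q = (p - 1 - q) / (p - 1) := by rw [hu]; field_simp
    rw [this, ht]; field_simp
  rw [← ENNReal.rpow_inv_le_iff ht0]
  refine le_sInf fun κ hκ => ?_
  rcases eq_or_ne κ ∞ with rfl | hκt
  · exact le_top
  have hle : ∀ i ∈ s, embC n α p q σ (E i) ≤ κ := fun i hi => by
    refine sInf_le fun ν hν => le_trans ?_ (hκ ν hν)
    gcongr
    exact subset_biUnion_of_mem (u := E) hi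
  rw [← one_mul (_ ^ t⁻¹)]
  refine ENNReal.mul_le_of_forall_lt fun c hc b hb => ?_
  refine (mul_le_mul_right hb.le c).trans ?_
  have hex : ∀ i ∈ s, ∃ ν : Measure (EuclideanSpace ℝ (Fin n)), IsFiniteMeasure ν ∧
      ν univ ≠ 0 ∧ (embC n α p q σ (E i) ≠ 0 → (c * embC n α p q σ (E i) * ν univ ^ u) ^ q ≤
        ∫⁻ y in E i, wolffPot n α p ν y ^ q ∂σ) := by
    intro i hi
    by_cases h0 : embC n α p q σ (E i) = 0
    · exact ⟨Measure.dirac 0, inferInstance, by simp, fun h => (h h0).elim⟩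
    · have hlt : c * embC n α p q σ (E i) < embC n α p q σ (E i) := by
        conv_rhs => rw [← one_mul (embC n α p q σ (E i))]
        exact ENNReal.mul_lt_mul_left h0 (ne_top_of_le_ne_top hκt (hle i hi)) hc
      obtain ⟨ν, h1, h2, h3⟩ := exists_lt_of_lt_embC hp hq hlt
      exact ⟨ν, h1, h2, fun _ => h3⟩
  choose! ν hνf hν0 hν using hex
  have hct : c ≠ ∞ := hc.ne_top
  set a : ι → ℝ≥0∞ := fun i => c * embC n α p q σ (E i) with ha
  have hat : ∀ i ∈ s, a i ≠ ∞ := fun i hi =>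
    ENNReal.mul_ne_top hct (ne_top_of_le_ne_top hκt (hle i hi))
  have hat' : ∀ i ∈ s, a i ^ t ≠ ∞ := fun i hi =>
    ENNReal.rpow_ne_top_of_nonneg ht0.le (hat i hi)
  set w : ι → ℝ≥0∞ := fun i => a i ^ t / ν i univ with hw
  have hwt : ∀ i ∈ s, w i ≠ ∞ := fun i hi => ENNReal.div_ne_top (hat' i hi) (hν0 i hi)
  set μ : Measure (EuclideanSpace ℝ (Fin n)) := ∑ i ∈ s, w i • ν i with hμ
  set A : ℝ≥0∞ := ∑ i ∈ s, a i ^ t with hA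
  have hAt : A ≠ ∞ := ENNReal.sum_ne_top.2 hat'
  have hμu : μ univ = A := by
    rw [hμ, Measure.finsetSum_apply]
    refine Finset.sum_congr rfl fun i hi => ?_
    have := hνf i hi
    rw [Measure.smul_apply, smul_eq_mul, hw, ENNReal.div_mul_cancel (hν0 i hi) (measure_ne_top _ _)]
  have hμf : IsFiniteMeasure μ := ⟨by rw [hμu]; exact hAt.lt_top⟩
  have hlow : A ≤ ∫⁻ y in ⋃ i ∈ s, E i, wolffPot n α p μ y ^ q ∂σ := by
    rw [lintegral_biUnion_finset hd hE]
    refine Finset.sum_le_sum fun i hi => ?_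
    have hfin := hνf i hi
    have hνle : w i • ν i ≤ μ := Measure.le_iff.2 fun F _ => by
      rw [hμ, Measure.finsetSum_apply]
      exact Finset.single_le_sum (f := fun i => (w i • ν i) F) (fun _ _ => zero_le) hi
    calc a i ^ t ≤ (w i ^ u) ^ q * ∫⁻ y in E i, wolffPot n α p (ν i) y ^ q ∂σ := by
          rcases eq_or_ne (embC n α p q σ (E i)) 0 with h0 | h0
          · simp [ha, h0, ENNReal.zero_rpow_of_pos ht0]
          refine le_trans (le_of_eq ?_) (mul_le_mul_right (hν i hi h0) _)
          rw [← ENNReal.mul_rpow_of_nonneg _ _ hq.le]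
          have : w i ^ u * (a i * ν i univ ^ u) = (a i ^ t) ^ u * a i := by
            rw [mul_comm (a i), ← mul_assoc, ← ENNReal.mul_rpow_of_nonneg _ _ hu0.le, hw,
              ENNReal.div_mul_cancel (hν0 i hi) (measure_ne_top _ _)]
          rw [this, ENNReal.mul_rpow_of_nonneg _ _ hq.le, ← ENNReal.rpow_mul, ← ENNReal.rpow_mul,
            ← ENNReal.rpow_add_of_nonneg _ _ (by positivity) hq.le, htu]
      _ = ∫⁻ y in E i, wolffPot n α p (w i • ν i) y ^ q ∂σ := by
          rw [← lintegral_const_mul' _ _ (ENNReal.rpow_ne_top_of_nonneg hq.le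
            (ENNReal.rpow_ne_top_of_nonneg hu0.le (hwt i hi)))]
          refine lintegral_congr fun y => ?_
          rw [wolffPot_smul hp _ (hwt i hi), ENNReal.mul_rpow_of_nonneg _ _ hq.le]
      _ ≤ _ := by
          refine lintegral_mono fun y => ?_
          exact ENNReal.rpow_le_rpow (wolffPot_mono hp hνle y) hq.le
  have hup : A ≤ κ ^ q * A ^ (u * q) := by
    have h := ENNReal.rpow_le_rpow (hκ μ hμf) hq.le
    rw [← ENNReal.rpow_mul, one_div_mul_cancel hq.ne', ENNReal.rpow_one, hμu,
      ENNReal.mul_rpow_of_nonneg _ _ hq.le, ← ENNReal.rpow_mul] at h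
    exact hlow.trans h
  have hAκ : A ≤ κ ^ t := by
    rcases eq_or_ne A 0 with h0 | h0
    · rw [h0]; exact zero_le
    have h1 : A ^ (1 - u * q) ≤ κ ^ q := by
      rw [ENNReal.rpow_sub _ _ h0 hAt, ENNReal.rpow_one]
      exact ENNReal.div_le_of_le_mul hup
    have h2 := ENNReal.rpow_le_rpow h1 (one_div_pos.2 huq).le
    rwa [← ENNReal.rpow_mul, ← ENNReal.rpow_mul, mul_one_div_cancel huq.ne', ENNReal.rpow_one,
      htu'] at h2
  have hAc : A = c ^ t * ∑ i ∈ s, embC n α p q σ (E i) ^ t := by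
    rw [hA, Finset.mul_sum]
    exact Finset.sum_congr rfl fun i _ => ENNReal.mul_rpow_of_nonneg _ _ ht0.le
  have h3 := ENNReal.rpow_le_rpow hAκ (inv_pos.2 ht0).le
  rwa [hAc, ENNReal.mul_rpow_of_nonneg _ _ (inv_pos.2 ht0).le, ← ENNReal.rpow_mul,
    ← ENNReal.rpow_mul, mul_inv_cancel₀ ht0.ne', ENNReal.rpow_one, ENNReal.rpow_one] at h3

lemma ENNReal.iSup_rpow_eq {ι : Sort*} {r : ℝ} (hr : 0 < r) (f : ι → ℝ≥0∞) :
    (⨆ i, f i) ^ r = ⨆ i, f i ^ r :=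
  (ENNReal.orderIsoRpow r hr).map_iSup f

/-- Contraction in mean, over the children of a cube, of a power `S ≤ 1` of the terms of the
intrinsic potential. -/
lemma sum_children_rpow_mul_volume_le {n : ℕ} {α p q : ℝ} (hp : 1 < p) (hq : 0 < q)
    (hqp : q < p - 1) (σ : Measure (EuclideanSpace ℝ (Fin n))) {S : ℝ} (hS0 : 0 < S) (hS1 : S ≤ 1)
    (k : ℤ) (m : Fin n → ℤ) :
    ∑ m' ∈ dyadicChildren n m,
      (embC n α p q σ (dyadicCube n (k + 1) m') ^ (q * (p - 1) / (p - 1 - q)) /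
        volume (dyadicCube n (k + 1) m') ^ (1 - α * p / (n : ℝ))) ^ S *
          volume (dyadicCube n (k + 1) m') ≤
      ENNReal.ofReal (((2 : ℝ) ^ n) ^ (-(S * (α * p / n)))) *
        ((embC n α p q σ (dyadicCube n k m) ^ (q * (p - 1) / (p - 1 - q)) /
          volume (dyadicCube n k m) ^ (1 - α * p / (n : ℝ))) ^ S *
            volume (dyadicCube n k m)) := by
  set t := q * (p - 1) / (p - 1 - q)
  set a := α * p / (n : ℝ)
  set v := volume (dyadicCube n k m) with hv
  have hv0 : v ≠ 0 := volume_dyadicCube_ne_zero k m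
  have hvt : v ≠ ∞ := volume_dyadicCube_ne_top k m
  set w : ℝ≥0∞ := 2 ^ n with hw
  have hw0 : w ≠ 0 := by simp [hw]
  have hwt : w ≠ ∞ := by simp [hw]
  have hterm : ∀ y u : ℝ≥0∞, u ≠ 0 → u ≠ ∞ →
      (y / u ^ (1 - a)) ^ S * u = y ^ S * u ^ (1 - (1 - a) * S) := by
    intro y u hu0 hut
    rw [ENNReal.div_rpow_of_nonneg _ _ hS0.le, ← ENNReal.rpow_mul, div_eq_mul_inv,
      ENNReal.rpow_sub _ _ hu0 hut, ENNReal.rpow_one, div_eq_mul_inv]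
    ring
  have hvc : ∀ m', volume (dyadicCube n (k + 1) m') = w⁻¹ * v := fun m' => by
    rw [volume_dyadicCube_succ k m, ENNReal.inv_pow]
  simp only [hvc]
  have hwv0 : w⁻¹ * v ≠ 0 := mul_ne_zero (ENNReal.inv_ne_zero.2 hwt) hv0
  have hwvt : w⁻¹ * v ≠ ∞ := ENNReal.mul_ne_top (ENNReal.inv_ne_top.2 hw0) hvt
  simp only [hterm _ _ hwv0 hwvt, hterm _ _ hv0 hvt]
  rw [← Finset.sum_mul]
  have hsuper := sum_embC_rpow_le (α := α) hp hq hqp σ (dyadicChildren n m)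
    (fun m' => dyadicCube n (k + 1) m') (fun m' _ => measurableSet_dyadicCube _ _)
    (fun _ _ _ _ hab => disjoint_dyadicCube _ hab)
  rw [← dyadicCube_eq_biUnion_children] at hsuper
  set x : (Fin n → ℤ) → ℝ≥0∞ := fun m' => embC n α p q σ (dyadicCube n (k + 1) m') ^ t
  set X : ℝ≥0∞ := embC n α p q σ (dyadicCube n k m) ^ t
  have hpow : ∑ m' ∈ dyadicChildren n m, x m' ^ S ≤ w ^ (1 - S) * X ^ S := by
    have h := ENNReal.rpow_sum_le_const_mul_sum_rpow (dyadicChildren n m) (fun m' => x m' ^ S)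
      (one_le_one_div hS0 hS1)
    simp only [← ENNReal.rpow_mul, mul_one_div_cancel hS0.ne', ENNReal.rpow_one,
      card_dyadicChildren] at h
    have h2 := ENNReal.rpow_le_rpow (h.trans (mul_le_mul_right hsuper _)) hS0.le
    rw [← ENNReal.rpow_mul, one_div_mul_cancel hS0.ne', ENNReal.rpow_one,
      ENNReal.mul_rpow_of_nonneg _ _ hS0.le, ← ENNReal.rpow_mul] at h2
    have e : (1 / S - 1) * S = 1 - S := by field_simp
    rw [e] at h2
    push_cast at h2
    exact h2
  have hδ : ENNReal.ofReal (((2 : ℝ) ^ n) ^ (-(S * a))) = w ^ (-(S * a)) := by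
    rw [← ENNReal.ofReal_rpow_of_pos (by positivity), ENNReal.ofReal_pow zero_le_two,
      ENNReal.ofReal_ofNat]
  calc _ ≤ w ^ (1 - S) * X ^ S * (w⁻¹ * v) ^ (1 - (1 - a) * S) := by gcongr
    _ = (w ^ (1 - S) * w ^ (-(1 - (1 - a) * S))) * (X ^ S * v ^ (1 - (1 - a) * S)) := by
        rw [ENNReal.mul_rpow_of_ne_top (ENNReal.inv_ne_top.2 hw0) hvt, ENNReal.inv_rpow,
          ENNReal.rpow_neg]
        ring
    _ = _ := by
        rw [hδ, ← ENNReal.rpow_add _ _ hw0 hwt]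
        congr 2
        ring

/-- The localized potential at `x` only involves the cubes containing `x`, one per generation. -/
lemma intKdLoc_le_tsum {n : ℕ} (hn : 1 ≤ n) {α p q : ℝ} (σ : Measure (EuclideanSpace ℝ (Fin n)))
    (k₀ : ℤ) (m₀ : Fin n → ℤ) (x : EuclideanSpace ℝ (Fin n)) :
    intKdLoc n α p q σ k₀ m₀ x ≤ ∑' j : ℕ,
      (embC n α p q σ (dyadicCube n (k₀ + j) (dyadicIndex n (k₀ + j) x)) ^
          (q * (p - 1) / (p - 1 - q)) /
        volume (dyadicCube n (k₀ + j) (dyadicIndex n (k₀ + j) x)) ^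
          (1 - α * p / (n : ℝ))) ^ (1 / (p - 1)) := by
  have hinj : Function.Injective fun j : ℕ => (k₀ + (j : ℤ), dyadicIndex n (k₀ + j) x) := by
    intro i j hij
    have := congrArg Prod.fst hij
    simpa using this
  rw [intKdLoc, ← hinj.tsum_eq]
  · exact ENNReal.tsum_le_tsum fun j =>
      (indicator_le_self _ _ _).trans (indicator_le_self _ _ _)
  · rintro ⟨k, m⟩ hkm
    rw [Function.mem_support, indicator_apply_ne_zero, mem_inter_iff, Function.mem_support] at hkm
    obtain ⟨hsub, hx⟩ := hkm
    have hx' : x ∈ dyadicCube n k m := mem_of_indicator_ne_zero hx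
    obtain ⟨j, hj⟩ := Int.le.dest (le_of_dyadicCube_subset hn hsub)
    refine ⟨j, ?_⟩
    simp only [hj, mem_dyadicCube_iff.1 hx']

/-- Localized dyadic enhanced Wolff inequality on a dyadic cube `P`, with constants
independent of `σ` and `P`. -/
theorem localized_dyadic_enhanced_wolff_inequality (n : ℕ) (hn : 1 ≤ n) (α p q r : ℝ)
    (hp : 1 < p) (hq0 : 0 < q) (hqp : q < p - 1)
    (hα0 : 0 < α) (hαp : α < n / p)
    (hr : (n : ℝ) * (p - 1) / ((n : ℝ) - α * p) < r) :
    ∃ c C : ℝ, 0 < c ∧ c ≤ C ∧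
      ∀ σ : Measure (EuclideanSpace ℝ (Fin n)), IsLocallyFiniteMeasure σ →
        ∀ (k₀ : ℤ) (m₀ : Fin n → ℤ),
        (ENNReal.ofReal c *
            (∫⁻ x in dyadicCube n k₀ m₀,
              ⨆ (km : ℤ × (Fin n → ℤ)) (_ : x ∈ dyadicCube n km.1 km.2)
                (_ : dyadicCube n km.1 km.2 ⊆ dyadicCube n k₀ m₀),
              (embC n α p q σ (dyadicCube n km.1 km.2) ^ (q * (p - 1) / (p - 1 - q)) /
                volume (dyadicCube n km.1 km.2) ^ (1 - α * p / (n : ℝ))) ^ (r / (p - 1))) ≤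
          ∫⁻ x in dyadicCube n k₀ m₀, intKdLoc n α p q σ k₀ m₀ x ^ r) ∧
        ((∫⁻ x in dyadicCube n k₀ m₀, intKdLoc n α p q σ k₀ m₀ x ^ r) ≤
          ENNReal.ofReal C *
            (∫⁻ x in dyadicCube n k₀ m₀,
              ⨆ (km : ℤ × (Fin n → ℤ)) (_ : x ∈ dyadicCube n km.1 km.2)
                (_ : dyadicCube n km.1 km.2 ⊆ dyadicCube n k₀ m₀),
              (embC n α p q σ (dyadicCube n km.1 km.2) ^ (q * (p - 1) / (p - 1 - q)) /
                volume (dyadicCube n km.1 km.2) ^ (1 - α * p / (n : ℝ))) ^ (r / (p - 1)))) := by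
  have hp1 : 0 < p - 1 := by linarith
  have hn0 : (0 : ℝ) < n := by exact_mod_cast hn
  have hαpn : α * p < n := (lt_div_iff₀ (by linarith)).1 hαp
  have hrp : p - 1 < r := by
    refine lt_of_le_of_lt ?_ hr
    rw [le_div_iff₀ (by linarith), mul_comm]
    have : 0 < α * p := by positivity
    gcongr
    linarith
  have hr0 : 0 < r := by linarith
  set θ : ℝ := min 1 (p - 1) with hθ
  have hθ0 : 0 < θ := lt_min one_pos hp1
  have hθ1 : θ ≤ 1 := min_le_left _ _
  have hθp : θ ≤ p - 1 := min_le_right _ _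
  set S : ℝ := θ / (p - 1) with hS
  have hS0 : 0 < S := by positivity
  have hS1 : S ≤ 1 := (div_le_one hp1).2 hθp
  set ρ : ℝ := r / θ with hρ
  have hρ1 : 1 < ρ := (one_lt_div hθ0).2 (by linarith)
  have ha0 : 0 < α * p / n := by positivity
  have hδ1 : ((2 : ℝ) ^ n) ^ (-(S * (α * p / n))) < 1 :=
    Real.rpow_lt_one_of_one_lt_of_neg (one_lt_pow₀ one_lt_two (by omega))
      (neg_neg_of_pos (by positivity))
  obtain ⟨C, hCt, hC⟩ := exists_lintegral_sum_rpow_le n hρ1 (by positivity) hδ1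
  refine ⟨1, max 1 C.toReal, one_pos, le_max_left _ _, fun σ _ k₀ m₀ => ?_⟩
  set base : ℤ × (Fin n → ℤ) → ℝ≥0∞ := fun km =>
    embC n α p q σ (dyadicCube n km.1 km.2) ^ (q * (p - 1) / (p - 1 - q)) /
      volume (dyadicCube n km.1 km.2) ^ (1 - α * p / (n : ℝ)) with hbase
  constructor
  · rw [ENNReal.ofReal_one, one_mul]
    refine lintegral_mono fun x => iSup_le fun km => iSup_le fun hx => iSup_le fun hsub => ?_
    have h1 : base km ^ (r / (p - 1)) = (base km ^ (1 / (p - 1))) ^ r := by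
      rw [← ENNReal.rpow_mul]; congr 1; ring
    refine h1.trans_le (ENNReal.rpow_le_rpow ?_ hr0.le)
    refine le_trans (le_of_eq ?_) (ENNReal.le_tsum km)
    rw [indicator_of_mem (by exact hsub), indicator_of_mem hx]
  · set sup : EuclideanSpace ℝ (Fin n) → ℝ≥0∞ := fun x =>
      ⨆ (km : ℤ × (Fin n → ℤ)) (_ : x ∈ dyadicCube n km.1 km.2)
        (_ : dyadicCube n km.1 km.2 ⊆ dyadicCube n k₀ m₀), base km ^ (r / (p - 1)) with hsup
    have hCle : C ≤ ENNReal.ofReal (max 1 C.toReal) :=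
      (ENNReal.ofReal_toReal hCt).symm.le.trans (ENNReal.ofReal_le_ofReal (le_max_right _ _))
    refine le_trans ?_ (mul_le_mul_left hCle _)
    set g : ℕ → EuclideanSpace ℝ (Fin n) → ℝ≥0∞ :=
      fun j x => base (k₀ + j, dyadicIndex n (k₀ + j) x) ^ (1 / (p - 1)) with hg
    have hgm : ∀ j, Measurable (g j) := fun j =>
      (Measurable.of_discrete (f := fun m => base (k₀ + j, m) ^ (1 / (p - 1)))).comp
        (measurable_dyadicIndex _)
    have hM := hC (fun k m => base (k, m) ^ S)
      (sum_children_rpow_mul_volume_le hp hq0 hqp σ hS0 hS1) k₀ m₀ (fun x => sup x ^ (1 / ρ))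
      (fun x hx j => ?_)
    · have hρinv : ∀ y : ℝ≥0∞, (y ^ (1 / ρ)) ^ ρ = y := fun y => by
        rw [← ENNReal.rpow_mul, one_div_mul_cancel (by linarith), ENNReal.rpow_one]
      simp only [hρinv] at hM
      calc ∫⁻ x in dyadicCube n k₀ m₀, intKdLoc n α p q σ k₀ m₀ x ^ r
          ≤ ∫⁻ x in dyadicCube n k₀ m₀, ⨆ N : ℕ, (∑ j ∈ Finset.range N, g j x) ^ r := by
            refine lintegral_mono fun x => ?_
            rw [← ENNReal.iSup_rpow_eq hr0, ← ENNReal.tsum_eq_iSup_nat]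
            exact ENNReal.rpow_le_rpow (intKdLoc_le_tsum hn σ k₀ m₀ x) hr0.le
        _ = ⨆ N : ℕ, ∫⁻ x in dyadicCube n k₀ m₀, (∑ j ∈ Finset.range N, g j x) ^ r := by
            refine lintegral_iSup
              (fun N => (Finset.measurable_fun_sum _ fun j _ => hgm j).pow_const _) ?_
            refine monotone_nat_of_le_succ fun N x => ENNReal.rpow_le_rpow ?_ hr0.le
            exact Finset.sum_le_sum_of_subset (by simp)
        _ ≤ _ := by
            refine iSup_le fun N => le_trans (lintegral_mono fun x => ?_) (hM N)
            have e : r = θ * ρ := by rw [hρ]; field_simp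
            rw [e, ENNReal.rpow_mul]
            refine ENNReal.rpow_le_rpow
              ((ENNReal.sum_rpow_le_rpow_sum _ _ hθ0 hθ1).trans (le_of_eq ?_)) (by linarith)
            refine Finset.sum_congr rfl fun j _ => ?_
            rw [hg, ← ENNReal.rpow_mul]
            congr 1
            rw [hS]; ring
    · have hsub := dyadicCube_subset_of_mem (by omega : k₀ ≤ k₀ + j) hx
        (mem_dyadicCube_dyadicIndex (k₀ + j) x)
      have e : S = (r / (p - 1)) * (1 / ρ) := by rw [hS, hρ]; field_simp
      rw [e, ENNReal.rpow_mul]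
      refine ENNReal.rpow_le_rpow ?_ (by positivity)
      exact le_iSup_of_le (k₀ + (j : ℤ), dyadicIndex n (k₀ + j) x)
        (le_iSup_of_le (mem_dyadicCube_dyadicIndex _ x) (le_iSup_of_le hsub le_rfl))
end

section
/- Let n ≥ 1, 1 < p < ∞, 0 < q < p−1, 0 < α < n/p, and let σ be a locally finite nonnegative Borel measure on ℝⁿ. Then for every x ∈ ℝⁿ, sup_{ρ>0} κ(B(x,ρ))^{q/(p−1−q)} / ρ^{(n−αp)/(p−1)} ≤ 2^{(n−αp)/(p−1)} (log 2) · K_{α,p,q}σ(x). -/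
open MeasureTheory Metric Set
open scoped ENNReal NNReal

/-- The set function `E ↦ κ(E)` is monotone. -/
theorem embC_mono (n : ℕ) (α p q : ℝ) (hq : 0 < q)
    (σ : Measure (EuclideanSpace ℝ (Fin n))) {E F : Set (EuclideanSpace ℝ (Fin n))}
    (hEF : E ⊆ F) : embC n α p q σ E ≤ embC n α p q σ F := by
  refine sInf_le_sInf fun κ hκ ν hν => le_trans ?_ (hκ ν hν)
  exact ENNReal.rpow_le_rpow (lintegral_mono_set hEF) (by positivity)

theorem self_le_two_rpow_mul_log_two {s : ℝ} (hs : 0 < s) :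
    s ≤ (2 : ℝ) ^ s * Real.log 2 := by
  have hlog := Real.log_two_gt_d9
  have he := Real.exp_one_gt_d9
  have key : Real.exp 1 * (Real.log 2 * s) ≤ (2 : ℝ) ^ s := by
    rw [Real.rpow_def_of_pos two_pos]
    calc Real.exp 1 * (Real.log 2 * s)
        ≤ Real.exp 1 * Real.exp (Real.log 2 * s - 1) := by
          gcongr
          linarith [Real.add_one_le_exp (Real.log 2 * s - 1)]
      _ = Real.exp (Real.log 2 * s) := by rw [← Real.exp_add]; ring_nf
  calc s ≤ 2.7 * (0.69 * s) * 0.69 := by linarith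
    _ ≤ Real.exp 1 * (Real.log 2 * s) * Real.log 2 := by gcongr <;> linarith
    _ ≤ (2 : ℝ) ^ s * Real.log 2 := by gcongr

theorem lintegral_Ioi_rpow_neg_sub_one {s c : ℝ} (hs : 0 < s) (hc : 0 < c) :
    ∫⁻ t in Ioi c, ENNReal.ofReal (t ^ (-s - 1)) = ENNReal.ofReal (c ^ (-s) / s) := by
  rw [← ofReal_integral_eq_lintegral_ofReal
    (integrableOn_Ioi_rpow_of_lt (by linarith) hc), integral_Ioi_rpow_of_lt (by linarith) hc]
  · rw [sub_add_cancel, neg_div_neg_eq]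
  · filter_upwards [ae_restrict_mem measurableSet_Ioi] with t ht
    exact Real.rpow_nonneg (hc.trans ht).le _

/-- Pointwise bound:
`sup_{ρ>0} κ(B(x,ρ))^{q/(p−1−q)}/ρ^{(n−αp)/(p−1)} ≤ 2^{(n−αp)/(p−1)} (log 2) K_{α,p,q}σ(x)`. -/
theorem sup_le_intK (n : ℕ) (hn : 1 ≤ n) (α p q : ℝ)
    (hp : 1 < p) (hq0 : 0 < q) (hqp : q < p - 1)
    (hα0 : 0 < α) (hαp : α < n / p)
    (σ : Measure (EuclideanSpace ℝ (Fin n))) (hσloc : IsLocallyFiniteMeasure σ)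
    (x : EuclideanSpace ℝ (Fin n)) :
    (⨆ (ρ : ℝ) (_ : 0 < ρ),
        embC n α p q σ (Metric.ball x ρ) ^ (q / (p - 1 - q)) /
          ENNReal.ofReal (ρ ^ (((n : ℝ) - α * p) / (p - 1)))) ≤
      ENNReal.ofReal ((2 : ℝ) ^ (((n : ℝ) - α * p) / (p - 1)) * Real.log 2) *
        intK n α p q σ x := by
  have hp1 : 0 < p - 1 := by linarith
  have hpq : 0 < p - 1 - q := by linarith
  have hd : 0 < (n : ℝ) - α * p := by
    have := (lt_div_iff₀ (by linarith : 0 < p)).1 hαp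
    linarith
  set s : ℝ := ((n : ℝ) - α * p) / (p - 1) with hs_def
  have hs : 0 < s := div_pos hd hp1
  refine iSup₂_le fun ρ hρ => ?_
  set A := embC n α p q σ (Metric.ball x ρ) ^ (q / (p - 1 - q)) with hA
  have integrand_ge : ∀ t ∈ Ioi ρ, A * ENNReal.ofReal (t ^ (-s - 1)) ≤
      (embC n α p q σ (Metric.ball x t) ^ (q * (p - 1) / (p - 1 - q)) /
        ENNReal.ofReal (t ^ ((n : ℝ) - α * p))) ^ (1 / (p - 1)) / ENNReal.ofReal t := by
    intro t ht
    have ht0 : 0 < t := hρ.trans ht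
    have hq' : q * (p - 1) / (p - 1 - q) * (1 / (p - 1)) = q / (p - 1 - q) := by
      field_simp
    rw [ENNReal.div_rpow_of_nonneg _ _ (by positivity), ← ENNReal.rpow_mul, hq',
      ENNReal.ofReal_rpow_of_pos (by positivity), ← Real.rpow_mul ht0.le, mul_one_div, ← hs_def,
      Real.rpow_sub_one ht0.ne', Real.rpow_neg ht0.le, ENNReal.ofReal_div_of_pos ht0,
      ENNReal.ofReal_inv_of_pos (by positivity), ← mul_div_assoc, ← div_eq_mul_inv]
    gcongr
    exact ENNReal.rpow_le_rpow (embC_mono n α p q hq0 σ (ball_subset_ball (le_of_lt ht)))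
      (by positivity)
  calc A / ENNReal.ofReal (ρ ^ s)
      = ENNReal.ofReal s * (A * ENNReal.ofReal (ρ ^ (-s) / s)) := by
        rw [mul_left_comm, ← ENNReal.ofReal_mul hs.le, mul_div_cancel₀ _ hs.ne',
          Real.rpow_neg hρ.le, ENNReal.ofReal_inv_of_pos (by positivity), div_eq_mul_inv]
    _ = ENNReal.ofReal s * ∫⁻ t in Ioi ρ, A * ENNReal.ofReal (t ^ (-s - 1)) := by
        rw [lintegral_const_mul _ (by fun_prop), lintegral_Ioi_rpow_neg_sub_one hs hρ]
    _ ≤ ENNReal.ofReal ((2 : ℝ) ^ s * Real.log 2) * intK n α p q σ x := by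
        refine mul_le_mul' (ENNReal.ofReal_le_ofReal (self_le_two_rpow_mul_log_two hs)) ?_
        exact (setLIntegral_mono' measurableSet_Ioi integrand_ge).trans
          (lintegral_mono_set (Ioi_subset_Ioi hρ.le))
end

section
/- Let n ≥ 1, 1 < p < ∞, 0 < q < p−1, and 0 < α < n/p. There exists a constant C = C(α,p,q,n) > 0 such that for every locally finite nonnegative Borel measure σ on ℝⁿ and every ball B = B(x,ρ) with σ(B) < ∞, σ(B) ≤ C · κ(B)^{q} · ρ^{q(n−αp)/(p−1)}; equivalently, σ(B)^{1/q} ρ^{−(n−αp)/(p−1)} ≤ C^{1/q} κ(B). -/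
open MeasureTheory Metric Set
open scoped ENNReal NNReal

/-- The Wolff potential of a unit point mass at `x` is bounded below on `B(x,ρ)`. -/
lemma le_wolffPot_dirac (n : ℕ) (α p : ℝ) (hp : 1 < p) (hαp : α * p ≤ n)
    (x y : EuclideanSpace ℝ (Fin n)) (ρ : ℝ) (hρ : 0 < ρ) (hy : y ∈ Metric.ball x ρ) :
    ENNReal.ofReal ((2 * ρ) ^ (-(((n : ℝ) - α * p) / (p - 1))) / 2) ≤
      wolffPot n α p (Measure.dirac x) y := by
  have hp1 : 0 < p - 1 := by linarith
  have key : ∀ r ∈ Set.Ioc ρ (2 * ρ),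
      ENNReal.ofReal ((2 * ρ) ^ (-(((n : ℝ) - α * p) / (p - 1))) / (2 * ρ)) ≤
        ((Measure.dirac x) (Metric.ball y r) / ENNReal.ofReal (r ^ ((n : ℝ) - α * p))) ^
          (1 / (p - 1)) / ENNReal.ofReal r := by
    intro r hr
    have hr0 : 0 < r := hρ.trans hr.1
    have hx : x ∈ Metric.ball y r := by
      rw [Metric.mem_ball, dist_comm]
      exact (Metric.mem_ball.1 hy).trans hr.1
    rw [Measure.dirac_apply' x measurableSet_ball, Set.indicator_of_mem hx, Pi.one_apply,
      ← ENNReal.ofReal_one, ← ENNReal.ofReal_div_of_pos (Real.rpow_pos_of_pos hr0 _),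
      ENNReal.ofReal_rpow_of_pos (by positivity), ← ENNReal.ofReal_div_of_pos hr0]
    apply ENNReal.ofReal_le_ofReal
    have e : (1 / r ^ ((n : ℝ) - α * p)) ^ (1 / (p - 1)) =
        r ^ (-(((n : ℝ) - α * p) / (p - 1))) := by
      rw [one_div, ← Real.rpow_neg hr0.le, ← Real.rpow_mul hr0.le]
      congr 1
      ring
    rw [e]
    have hs : 0 ≤ ((n : ℝ) - α * p) / (p - 1) := div_nonneg (by linarith) hp1.le
    exact div_le_div₀ (by positivity)
      (Real.rpow_le_rpow_of_nonpos hr0 hr.2 (by linarith)) hr0 hr.2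
  calc ENNReal.ofReal ((2 * ρ) ^ (-(((n : ℝ) - α * p) / (p - 1))) / 2)
      = ∫⁻ _ in Set.Ioc ρ (2 * ρ),
          ENNReal.ofReal ((2 * ρ) ^ (-(((n : ℝ) - α * p) / (p - 1))) / (2 * ρ)) := by
        rw [setLIntegral_const, Real.volume_Ioc, ← ENNReal.ofReal_mul (by positivity)]
        congr 1
        field_simp
        ring
    _ ≤ ∫⁻ r in Set.Ioc ρ (2 * ρ),
          ((Measure.dirac x) (Metric.ball y r) / ENNReal.ofReal (r ^ ((n : ℝ) - α * p))) ^
            (1 / (p - 1)) / ENNReal.ofReal r := setLIntegral_mono' measurableSet_Ioc key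
    _ ≤ wolffPot n α p (Measure.dirac x) y :=
        lintegral_mono_set fun r hr => hρ.trans hr.1

/-- A lower bound for the Wolff potential of a probability measure on `E` bounds `κ(E)` below. -/
lemma mul_measure_le_embC_rpow (n : ℕ) (α p q : ℝ) (hq : 0 < q)
    (σ : Measure (EuclideanSpace ℝ (Fin n))) {E : Set (EuclideanSpace ℝ (Fin n))}
    (hE : MeasurableSet E) (ν : Measure (EuclideanSpace ℝ (Fin n))) [IsProbabilityMeasure ν]
    (L : ℝ≥0∞) (hL : ∀ y ∈ E, L ≤ wolffPot n α p ν y) :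
    L ^ q * σ E ≤ embC n α p q σ E ^ q := by
  have h : (L ^ q * σ E) ^ (1 / q) ≤ embC n α p q σ E := by
    refine le_sInf fun κ hκ => ?_
    have h1 := hκ ν inferInstance
    rw [measure_univ, ENNReal.one_rpow, mul_one] at h1
    refine le_trans (ENNReal.rpow_le_rpow ?_ (by positivity)) h1
    rw [← setLIntegral_const]
    exact setLIntegral_mono' hE fun y hy => ENNReal.rpow_le_rpow (hL y hy) hq.le
  rw [one_div] at h
  exact (ENNReal.rpow_inv_le_iff hq).1 h


/-- There is `C = C(α,p,q,n) > 0` such that for every ball `B = B(x,ρ)` with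
`σ(B) < ∞`, `σ(B) ≤ C κ(B)^q ρ^{q(n−αp)/(p−1)}`. -/
theorem measure_ball_le_embC (n : ℕ) (hn : 1 ≤ n) (α p q : ℝ)
    (hp : 1 < p) (hq0 : 0 < q) (hqp : q < p - 1)
    (hα0 : 0 < α) (hαp : α < n / p) :
    ∃ C : ℝ, 0 < C ∧
      ∀ σ : Measure (EuclideanSpace ℝ (Fin n)), IsLocallyFiniteMeasure σ →
        ∀ (x : EuclideanSpace ℝ (Fin n)) (ρ : ℝ), 0 < ρ →
          σ (Metric.ball x ρ) < ⊤ →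
          σ (Metric.ball x ρ) ≤
            ENNReal.ofReal C * embC n α p q σ (Metric.ball x ρ) ^ q *
              ENNReal.ofReal (ρ ^ (q * ((n : ℝ) - α * p) / (p - 1))) := by
  have hp0 : 0 < p := by linarith
  have hαp' : α * p ≤ n := ((lt_div_iff₀ hp0).1 hαp).le
  refine ⟨(2 * 2 ^ (((n : ℝ) - α * p) / (p - 1))) ^ q, by positivity, ?_⟩
  intro σ _ x ρ hρ _
  have h := mul_measure_le_embC_rpow n α p q hq0 σ measurableSet_ball (Measure.dirac x) _
    fun y hy => le_wolffPot_dirac n α p hp hαp' x y ρ hρ hy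
  set s := ((n : ℝ) - α * p) / (p - 1) with hs
  have hexp : q * ((n : ℝ) - α * p) / (p - 1) = s * q := by rw [hs]; ring
  rw [ENNReal.ofReal_rpow_of_pos (by positivity)] at h
  have hone : (2 * 2 ^ s) ^ q * ρ ^ (s * q) * ((2 * ρ) ^ (-s) / 2) ^ q = 1 := by
    rw [Real.rpow_mul hρ.le, ← Real.mul_rpow (by positivity) (by positivity),
      ← Real.mul_rpow (by positivity) (by positivity), Real.rpow_neg (by positivity),
      Real.mul_rpow zero_le_two hρ.le]
    have e : 2 * (2 : ℝ) ^ s * ρ ^ s * ((2 ^ s * ρ ^ s)⁻¹ / 2) = 1 := by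
      have h1 : (2 : ℝ) ^ s ≠ 0 := by positivity
      have h2 : ρ ^ s ≠ 0 := by positivity
      field_simp
    rw [e, Real.one_rpow]
  rw [hexp]
  calc σ (Metric.ball x ρ)
      = ENNReal.ofReal ((2 * 2 ^ s) ^ q) * ENNReal.ofReal (ρ ^ (s * q)) *
          (ENNReal.ofReal (((2 * ρ) ^ (-s) / 2) ^ q) * σ (Metric.ball x ρ)) := by
        rw [← mul_assoc, ← ENNReal.ofReal_mul (by positivity),
          ← ENNReal.ofReal_mul (by positivity), hone, ENNReal.ofReal_one, one_mul]
    _ ≤ ENNReal.ofReal ((2 * 2 ^ s) ^ q) * ENNReal.ofReal (ρ ^ (s * q)) *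
          embC n α p q σ (Metric.ball x ρ) ^ q := by gcongr
    _ = _ := mul_right_comm _ _ _
end
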